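/- Let F be a field of characteristic 0. Every sequence q_1 q_2 ⋯ q_n with each q_k ∈ {A, S} and q_n = A is attainable over F, i.e., there exists an n×n symmetric matrix over F whose qpr-sequence is q_1 q_2 ⋯ q_n. -/

import Mathlib

open Matrix

/-- The minor of a square matrix `B` lying in the rows indexed by `α` and the columns
indexed by `β` (each listed in increasing order); junk value `0` if `α.card ≠ β.card`. -/
def qMinor {R : Type*} [CommRing R] {m : Type*} [Fintype m] [LinearOrder m]
    (B : Matrix m m R) (α β : Finset m) : R :=
  if h : β.card = α.card then
    (Matrix.of fun i j : Fin α.card =>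
      B (α.orderEmbOfFin rfl i) (β.orderEmbOfFin h j)).det
  else 0

/-- `α` and `β` index a quasi-principal submatrix of order `k`, i.e.
`|α| = |β| = k` and `k - 1 ≤ |α ∩ β| (≤ k)`. -/
def IsQPPair {m : Type*} [DecidableEq m] (k : ℕ) (α β : Finset m) : Prop :=
  α.card = k ∧ β.card = k ∧ k - 1 ≤ (α ∩ β).card

/-- All quasi-principal minors of `B` of order `k` are nonzero. -/
def QPAllNonzero {R : Type*} [CommRing R] {m : Type*} [Fintype m] [LinearOrder m]
    (B : Matrix m m R) (k : ℕ) : Prop :=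
  ∀ α β : Finset m, IsQPPair k α β → qMinor B α β ≠ 0

/-- All quasi-principal minors of `B` of order `k` are zero. -/
def QPAllZero {R : Type*} [CommRing R] {m : Type*} [Fintype m] [LinearOrder m]
    (B : Matrix m m R) (k : ℕ) : Prop :=
  ∀ α β : Finset m, IsQPPair k α β → qMinor B α β = 0

/-- The three possible letters of a qpr-sequence. -/
inductive QPR : Type
  | A
  | S
  | N
deriving DecidableEq

open Classical in
/-- The letter of the qpr-sequence of `B` corresponding to order `k`:
`A` if all quasi-principal minors of order `k` are nonzero, `N` if all are zero,
and `S` otherwise. -/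
noncomputable def qprEntry {R : Type*} [CommRing R] {m : Type*} [Fintype m] [LinearOrder m]
    (B : Matrix m m R) (k : ℕ) : QPR :=
  if QPAllNonzero B k then QPR.A
  else if QPAllZero B k then QPR.N
  else QPR.S

/-- A sequence of letters `q 0, …, q (n-1)` (standing for `q_1 ⋯ q_n`) is attainable
over `F` if it is the qpr-sequence of an `n × n` symmetric matrix over `F`. -/
def Attainable (F : Type*) [Field F] {n : ℕ} (q : Fin n → QPR) : Prop :=
  ∃ B : Matrix (Fin n) (Fin n) F, B.IsSymm ∧ ∀ k : Fin n, qprEntry B ((k : ℕ) + 1) = q k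

/-- The Schur complement `B/B[γ] = B[γᶜ] - B[γᶜ, γ] B[γ]⁻¹ B[γ, γᶜ]`,
with rows and columns indexed by `γᶜ` (indexing inherited from `B`). -/
noncomputable def schurCompl {R : Type*} [CommRing R] {n : ℕ}
    (B : Matrix (Fin n) (Fin n) R) (γ : Finset (Fin n)) :
    Matrix ↥(γᶜ) ↥(γᶜ) R :=
  B.submatrix (fun i : ↥(γᶜ) => (i : Fin n)) (fun j : ↥(γᶜ) => (j : Fin n)) -
    B.submatrix (fun i : ↥(γᶜ) => (i : Fin n)) (fun j : ↥γ => (j : Fin n)) *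
      (B.submatrix (fun i : ↥γ => (i : Fin n)) fun j : ↥γ => (j : Fin n))⁻¹ *
      B.submatrix (fun i : ↥γ => (i : Fin n)) fun j : ↥(γᶜ) => (j : Fin n)

/-- The `(m+1) × (m+1)` matrix with block form `[[A, x], [yᵀ, b]]`. -/
def borderMat {R : Type*} [CommRing R] {m : ℕ} (A : Matrix (Fin m) (Fin m) R)
    (x y : Fin m → R) (b : R) : Matrix (Fin (m + 1)) (Fin (m + 1)) R :=
  Matrix.of fun i j =>
    if hi : (i : ℕ) < m then
      if hj : (j : ℕ) < m then A ⟨i, hi⟩ ⟨j, hj⟩ else x ⟨i, hi⟩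
    else
      if hj : (j : ℕ) < m then y ⟨j, hj⟩ else b


section Helpers

/-- Allowed positions of the lower triangular factor. -/
def qT {n : ℕ} (q : Fin n → QPR) (x y : Fin n) : Prop :=
  y ≤ x ∧ ((x : ℕ) + 1 = n → q y = QPR.A)

/-- Combinatorial condition guaranteeing a generically nonzero minor. -/
def qGood {n : ℕ} (q : Fin n → QPR) (α β : Finset (Fin n)) : Prop :=
  ∃ f g : Fin n → Fin n, Set.InjOn f α ∧ Set.InjOn g β ∧ α.image f = β.image g ∧
    (∀ x ∈ α, qT q x (f x)) ∧ ∀ x ∈ β, qT q x (g x)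

/-- The product `P D Pᵀ`. -/
def qFam {R : Type*} [CommRing R] {n : ℕ} (P : Matrix (Fin n) (Fin n) R) (d : Fin n → R) :
    Matrix (Fin n) (Fin n) R := P * Matrix.diagonal d * Pᵀ

open Classical in
/-- The masked matrix. -/
noncomputable def qMask {R : Type*} [CommRing R] {n : ℕ} (q : Fin n → QPR)
    (P : Fin n → Fin n → R) : Matrix (Fin n) (Fin n) R :=
  Matrix.of fun x y => if qT q x y then P x y else 0

lemma qFam_symm {R : Type*} [CommRing R] {n : ℕ} (P : Matrix (Fin n) (Fin n) R) (d : Fin n → R) :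
    (qFam P d).IsSymm := by
  unfold qFam Matrix.IsSymm
  simp [Matrix.transpose_mul, Matrix.mul_assoc]

lemma qFam_det {R : Type*} [CommRing R] {n k : ℕ} (P : Matrix (Fin n) (Fin n) R) (d : Fin n → R)
    (a b c : Fin k → Fin n) (hc : Function.Injective c)
    (h : ∀ i x, x ∉ Set.range c → P (a i) x * d x = 0) :
    ((qFam P d).submatrix a b).det =
      (P.submatrix a c).det * (∏ i, d (c i)) * (P.submatrix b c).det := by
  have : (qFam P d).submatrix a b =
      P.submatrix a c * Matrix.diagonal (d ∘ c) * (P.submatrix b c)ᵀ := by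
    ext i j
    simp only [qFam, Matrix.submatrix_apply, Matrix.mul_apply (M := _ * _), Matrix.mul_diagonal,
      Matrix.transpose_apply, Function.comp]
    rw [← Finset.sum_image (s := Finset.univ) (g := c)
      (f := fun x => P (a i) x * d x * P (b j) x) (fun _ _ _ _ e => hc e)]
    symm
    apply Finset.sum_subset (Finset.subset_univ _)
    intro x _ hx
    rw [h i x (by simpa using hx), zero_mul]
  rw [this, Matrix.det_mul, Matrix.det_mul, Matrix.det_diagonal, Matrix.det_transpose]
  rfl

lemma qMinor_eq {R : Type*} [CommRing R] {n : ℕ} (B : Matrix (Fin n) (Fin n) R)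
    (α β : Finset (Fin n)) (h : β.card = α.card) :
    qMinor B α β = (B.submatrix (α.orderEmbOfFin rfl) (β.orderEmbOfFin h)).det := by
  unfold qMinor
  rw [dif_pos h]
  rfl

lemma qMinor_map {R R' : Type*} [CommRing R] [CommRing R'] (φ : R →+* R') {n : ℕ}
    (B : Matrix (Fin n) (Fin n) R) (α β : Finset (Fin n)) :
    φ (qMinor B α β) = qMinor (B.map φ) α β := by
  unfold qMinor
  split_ifs with h
  · rw [RingHom.map_det]; rfl
  · simp

lemma qFam_map {R R' : Type*} [CommRing R] [CommRing R'] (φ : R →+* R') {n : ℕ}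
    (P : Matrix (Fin n) (Fin n) R) (d : Fin n → R) :
    (qFam P d).map φ = qFam (P.map φ) (fun i => φ (d i)) := by
  unfold qFam
  rw [Matrix.map_mul, Matrix.map_mul, Matrix.diagonal_map (map_zero φ), Matrix.transpose_map]

lemma qMask_map {R R' : Type*} [CommRing R] [CommRing R'] (φ : R →+* R') {n : ℕ}
    (q : Fin n → QPR) (P : Fin n → Fin n → R) :
    (qMask q P).map φ = qMask q (fun x y => φ (P x y)) := by
  ext x y
  simp only [qMask, Matrix.map_apply, Matrix.of_apply]
  split_ifs <;> simp

lemma qMask_det_ne {F : Type*} [Field F] {n k : ℕ} (q : Fin n → QPR) (a : Fin k → Fin n)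
    (f : Fin n → Fin n) (hf : Function.Injective (f ∘ a)) (hT : ∀ i, qT q (a i) (f (a i))) :
    ((qMask q (fun x y => (MvPolynomial.X (x, y) : MvPolynomial (Fin n × Fin n) F))).submatrix
      a (f ∘ a)).det ≠ 0 := by
  intro h0
  have h1 := congrArg (MvPolynomial.eval
    (fun p : Fin n × Fin n => if p.2 = f p.1 then (1 : F) else 0)) h0
  rw [RingHom.map_det, map_zero] at h1
  have : (MvPolynomial.eval
    (fun p : Fin n × Fin n => if p.2 = f p.1 then (1 : F) else 0)).mapMatrix
    ((qMask q (fun x y => (MvPolynomial.X (x, y) : MvPolynomial (Fin n × Fin n) F))).submatrix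
      a (f ∘ a)) = 1 := by
    ext i j
    simp only [RingHom.mapMatrix_apply, Matrix.map_apply, Matrix.submatrix_apply, qMask,
      Matrix.of_apply, Matrix.one_apply]
    by_cases hij : i = j
    · subst hij
      simp [hT i]
    · have : f (a j) ≠ f (a i) := fun e => hij (hf e).symm
      simp only [hij, if_false]
      split_ifs <;> simp [this]
  rw [this, Matrix.det_one] at h1
  exact one_ne_zero h1

/-- The generic matrix. -/
noncomputable def qGen (F : Type*) [Field F] {n : ℕ} (q : Fin n → QPR) :
    Matrix (Fin n) (Fin n) (MvPolynomial ((Fin n × Fin n) ⊕ Fin n) F) :=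
  qFam (qMask q (fun x y => MvPolynomial.X (Sum.inl (x, y)))) (fun i => MvPolynomial.X (Sum.inr i))

lemma qGen_ne {F : Type*} [Field F] {n : ℕ} (q : Fin n → QPR) (α β : Finset (Fin n))
    (h : qGood q α β) : qMinor (qGen F q) α β ≠ 0 := by
  classical
  obtain ⟨f, g, hf, hg, him, hTf, hTg⟩ := h
  have hcard : β.card = α.card := by
    rw [← Finset.card_image_of_injOn hf, ← Finset.card_image_of_injOn hg, him]
  intro h0
  let φ : MvPolynomial ((Fin n × Fin n) ⊕ Fin n) F →+* MvPolynomial (Fin n × Fin n) F :=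
    (MvPolynomial.aeval (Sum.elim (fun p => MvPolynomial.X p)
      (fun i => if i ∈ α.image f then 1 else 0))).toRingHom
  have h1 := congrArg φ h0
  rw [qMinor_map, map_zero, qGen, qFam_map, qMask_map, qMinor_eq _ _ _ hcard] at h1
  have e1 : ∀ x y : Fin n, φ (MvPolynomial.X (Sum.inl (x, y))) = MvPolynomial.X (x, y) := by
    intro x y; simp [φ]
  have e2 : ∀ i : Fin n, φ (MvPolynomial.X (Sum.inr i)) = if i ∈ α.image f then 1 else 0 := by
    intro i; simp only [φ, AlgHom.toRingHom_eq_coe, RingHom.coe_coe, MvPolynomial.aeval_X, Sum.elim_inr]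
  simp only [e1, e2] at h1
  set a := α.orderEmbOfFin rfl with ha
  set b := β.orderEmbOfFin hcard with hb
  have hma : ∀ i, a i ∈ α := fun i => Finset.orderEmbOfFin_mem _ _ _
  have hmb : ∀ i, b i ∈ β := fun i => Finset.orderEmbOfFin_mem _ _ _
  have hfa : Function.Injective (f ∘ a) := fun i j e => a.injective (hf (hma i) (hma j) e)
  have hgb : Function.Injective (g ∘ b) := fun i j e => b.injective (hg (hmb i) (hmb j) e)
  have hra : ∀ x, x ∈ α.image f → ∃ i, f (a i) = x := by
    intro x hx
    obtain ⟨y, hy, rfl⟩ := Finset.mem_image.1 hx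
    have : y ∈ Set.range a := by rw [ha, Finset.range_orderEmbOfFin]; exact hy
    obtain ⟨i, rfl⟩ := this
    exact ⟨i, rfl⟩
  have hrb : ∀ x, x ∈ α.image f → ∃ i, g (b i) = x := by
    intro x hx
    rw [him] at hx
    obtain ⟨y, hy, rfl⟩ := Finset.mem_image.1 hx
    have : y ∈ Set.range b := by rw [hb, Finset.range_orderEmbOfFin]; exact hy
    obtain ⟨i, rfl⟩ := this
    exact ⟨i, rfl⟩
  rw [qFam_det _ _ a b (f ∘ a) hfa] at h1
  · have hτ : ∀ i, ∃ j, g (b j) = f (a i) := fun i => hrb _ (Finset.mem_image_of_mem _ (hma i))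
    choose τ hτ using hτ
    have hτi : Function.Injective τ := by
      intro i j e
      apply hfa
      simp only [Function.comp]
      rw [← hτ i, ← hτ j, e]
    let σ : Equiv.Perm (Fin α.card) := Equiv.ofBijective τ (Finite.injective_iff_bijective.1 hτi)
    have hc : (f ∘ a : Fin α.card → Fin n) = (g ∘ b) ∘ σ := by
      funext i; simp [σ, hτ]
    have hprod : (∏ i, if (f ∘ a) i ∈ α.image f then (1 : MvPolynomial (Fin n × Fin n) F) else 0) = 1 := by
      apply Finset.prod_eq_one
      intro i _
      exact if_pos (Finset.mem_image_of_mem f (hma i))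
    rw [hprod, mul_one] at h1
    rcases mul_eq_zero.1 h1 with h2 | h2
    · exact qMask_det_ne q a f hfa (fun i => hTf _ (hma i)) h2
    · rw [hc] at h2
      have h3 := Matrix.det_permute' σ ((qMask q (fun x y => (MvPolynomial.X (x, y) :
        MvPolynomial (Fin n × Fin n) F))).submatrix b (g ∘ b))
      rw [Matrix.submatrix_submatrix] at h3
      erw [h2] at h3
      have h4 := qMask_det_ne (F := F) q b g hgb (fun i => hTg _ (hmb i))
      rcases mul_eq_zero.1 h3.symm with h5 | h5
      · rcases Int.units_eq_one_or (Equiv.Perm.sign σ) with h6 | h6 <;> simp [h6] at h5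
      · exact h4 h5
  · intro i x hx
    rw [if_neg, mul_zero]
    intro hx'
    obtain ⟨i, hi⟩ := hra x hx'
    exact hx ⟨i, hi⟩

lemma exists_point {F : Type*} [Field F] [CharZero F] {n : ℕ} (q : Fin n → QPR) :
    ∃ (P : Fin n → Fin n → F) (d : Fin n → F), ∀ α β, qGood q α β →
      qMinor (qFam (qMask q P) d) α β ≠ 0 := by
  classical
  have hne : (∏ p ∈ (Finset.univ : Finset (Finset (Fin n) × Finset (Fin n))).filter
      (fun p => qGood q p.1 p.2), qMinor (qGen F q) p.1 p.2) ≠ 0 := by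
    rw [Finset.prod_ne_zero_iff]
    intro p hp
    exact qGen_ne q _ _ (Finset.mem_filter.1 hp).2
  have : ∃ v, MvPolynomial.eval v (∏ p ∈ (Finset.univ : Finset (Finset (Fin n) × Finset (Fin n))).filter
      (fun p => qGood q p.1 p.2), qMinor (qGen F q) p.1 p.2) ≠ 0 := by
    by_contra! hcon
    exact hne (MvPolynomial.funext (fun v => by rw [hcon v, map_zero]))
  obtain ⟨v, hv⟩ := this
  rw [map_prod, Finset.prod_ne_zero_iff] at hv
  refine ⟨fun x y => v (Sum.inl (x, y)), fun i => v (Sum.inr i), fun α β h => ?_⟩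
  have := hv (α, β) (by simpa using h)
  rw [qMinor_map, qGen, qFam_map, qMask_map] at this
  simpa using this

lemma qGood.symm {n : ℕ} {q : Fin n → QPR} {α β : Finset (Fin n)} (h : qGood q α β) :
    qGood q β α := by
  obtain ⟨f, g, h1, h2, h3, h4, h5⟩ := h
  exact ⟨g, f, h2, h1, h3.symm, h5, h4⟩

lemma qT_self {n : ℕ} (q : Fin n → QPR) (hl : ∀ x : Fin n, (x : ℕ) + 1 = n → q x = QPR.A)
    (x : Fin n) : qT q x x := ⟨le_refl _, hl x⟩

lemma qGood_refl {n : ℕ} (q : Fin n → QPR) (hl : ∀ x : Fin n, (x : ℕ) + 1 = n → q x = QPR.A)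
    (α : Finset (Fin n)) : qGood q α α :=
  ⟨id, id, Function.injective_id.injOn, Function.injective_id.injOn, rfl,
    fun x _ => qT_self q hl x, fun x _ => qT_self q hl x⟩

lemma qGood_lt {n : ℕ} (q : Fin n → QPR) (hl : ∀ x : Fin n, (x : ℕ) + 1 = n → q x = QPR.A)
    (σ : Finset (Fin n)) (i j κ : Fin n) (hi : i ∉ σ) (hj : j ∉ σ) (hij : i < j)
    (hκ : q κ = QPR.A) (hc : σ.card = κ) : qGood q (insert i σ) (insert j σ) := by
  have hT : ∀ x y : Fin n, y ≤ x → x < j → qT q x y := fun x y h h' => ⟨h, fun e => by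
    have := j.2; omega⟩
  have hTκ : ∀ x : Fin n, κ ≤ x → qT q x κ := fun x h => ⟨h, fun _ => hκ⟩
  have hS := qT_self q hl
  by_cases h1 : qT q j i
  · refine ⟨id, fun x => if x = j then i else x, ?_, ?_, ?_, ?_, ?_⟩
    · exact Function.injective_id.injOn
    · intro x hx y hy; simp only [Finset.coe_insert, Set.mem_insert_iff, Finset.mem_coe] at hx hy; grind
    · ext x; simp only [Finset.mem_image, Finset.mem_insert]; grind
    · intro x _; exact hS x
    · intro x _; grind
  have hjn : (j : ℕ) + 1 = n := by
    by_contra h; exact h1 ⟨hij.le, fun e => absurd e h⟩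
  have hiA : q i ≠ QPR.A := fun h => h1 ⟨hij.le, fun _ => h⟩
  have hiκ : i ≠ κ := fun e => hiA (e ▸ hκ)
  have hlej : ∀ x, x ≤ j := fun x => by have := x.2; omega
  have hltj : ∀ x ∈ σ, x < j := fun x hx => lt_of_le_of_ne (hlej x) (fun e => hj (e ▸ hx))
  have hκj : κ ≠ j := by
    rintro rfl
    have := Finset.card_le_univ (insert i (insert κ σ))
    rw [Finset.card_insert_of_notMem (by simp [hi, hiκ]), Finset.card_insert_of_notMem hj] at this
    simp at this
    omega
  by_cases h2 : κ ∈ σ <;> rcases lt_or_gt_of_ne hiκ with h3 | h3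
  · refine ⟨id, fun x => if x = j then κ else if x = κ then i else x, ?_, ?_, ?_, ?_, ?_⟩
    · exact Function.injective_id.injOn
    · intro x hx y hy; simp only [Finset.coe_insert, Set.mem_insert_iff, Finset.mem_coe] at hx hy; grind
    · ext x; simp only [Finset.mem_image, Finset.mem_insert]; grind
    · intro x _; exact hS x
    · intro x _; grind
  · obtain ⟨g, hg, hgσ⟩ : ∃ g : Fin n, g < κ ∧ g ∉ σ := by
      by_contra! hcon
      have : Finset.Iic κ ⊆ σ := by
        intro x hx
        rcases (Finset.mem_Iic.1 hx).lt_or_eq with h | h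
        · exact hcon x h
        · exact h ▸ h2
      have := Finset.card_le_card this
      simp at this
      omega
    refine ⟨fun x => if x = i then g else x,
      fun x => if x = j then κ else if x = κ then g else x, ?_, ?_, ?_, ?_, ?_⟩
    · intro x hx y hy; simp only [Finset.coe_insert, Set.mem_insert_iff, Finset.mem_coe] at hx hy; grind
    · intro x hx y hy; simp only [Finset.coe_insert, Set.mem_insert_iff, Finset.mem_coe] at hx hy; grind
    · ext x; simp only [Finset.mem_image, Finset.mem_insert]; grind
    · intro x hx; grind
    · intro x hx; grind
  · obtain ⟨s, hs, hsσ⟩ : ∃ s : Fin n, κ < s ∧ s ∈ σ := by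
      by_contra! hcon
      have : insert i σ ⊆ Finset.Iio κ := by
        intro x hx
        rw [Finset.mem_Iio]
        rcases Finset.mem_insert.1 hx with rfl | h
        · exact h3
        · by_contra h'
          rcases (not_lt.1 h').lt_or_eq with h4 | h4
          · exact hcon x h4 h
          · exact h2 (h4 ▸ h)
      have := Finset.card_le_card this
      rw [Finset.card_insert_of_notMem hi] at this
      simp at this
      omega
    refine ⟨fun x => if x = s then κ else x,
      fun x => if x = j then κ else if x = s then i else x, ?_, ?_, ?_, ?_, ?_⟩
    · intro x hx y hy; simp only [Finset.coe_insert, Set.mem_insert_iff, Finset.mem_coe] at hx hy; grind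
    · intro x hx y hy; simp only [Finset.coe_insert, Set.mem_insert_iff, Finset.mem_coe] at hx hy; grind
    · ext x; simp only [Finset.mem_image, Finset.mem_insert]; grind
    · intro x hx; grind
    · intro x hx; grind
  · refine ⟨fun x => if x = i then κ else x, fun x => if x = j then κ else x, ?_, ?_, ?_, ?_, ?_⟩
    · intro x hx y hy; simp only [Finset.coe_insert, Set.mem_insert_iff, Finset.mem_coe] at hx hy; grind
    · intro x hx y hy; simp only [Finset.coe_insert, Set.mem_insert_iff, Finset.mem_coe] at hx hy; grind
    · ext x; simp only [Finset.mem_image, Finset.mem_insert]; grind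
    · intro x hx; grind
    · intro x hx; grind

lemma qGood_pair {n : ℕ} (q : Fin n → QPR) (hl : ∀ x : Fin n, (x : ℕ) + 1 = n → q x = QPR.A)
    (κ : Fin n) (hκ : q κ = QPR.A) (α β : Finset (Fin n)) (h : IsQPPair ((κ : ℕ) + 1) α β) :
    qGood q α β := by
  obtain ⟨h1, h2, h3⟩ := h
  by_cases hab : α = β
  · subst hab; exact qGood_refl q hl α
  have hlt : (α ∩ β).card < α.card := by
    apply Finset.card_lt_card
    refine Finset.ssubset_iff_subset_ne.2 ⟨Finset.inter_subset_left, fun e => hab ?_⟩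
    exact Finset.eq_of_subset_of_card_le (Finset.inter_eq_left.1 e) (by omega)
  have hσ : (α ∩ β).card = κ := by omega
  have hA : (α \ β).card = 1 := by
    have := Finset.card_sdiff_add_card_inter α β; omega
  have hB : (β \ α).card = 1 := by
    have := Finset.card_sdiff_add_card_inter β α
    rw [Finset.inter_comm] at this; omega
  obtain ⟨i, hi⟩ := Finset.card_eq_one.1 hA
  obtain ⟨j, hj⟩ := Finset.card_eq_one.1 hB
  have hi' : i ∈ α \ β := by simp [hi]
  have hj' : j ∈ β \ α := by simp [hj]
  rw [Finset.mem_sdiff] at hi' hj'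
  have ea : α = insert i (α ∩ β) := by
    rw [← Finset.sdiff_union_inter α β, hi]; ext x; simp; grind
  have eb : β = insert j (α ∩ β) := by
    have := Finset.sdiff_union_inter β α
    rw [hj, Finset.inter_comm] at this
    exact this.symm
  have hij : i ≠ j := fun e => hi'.2 (e ▸ hj'.1)
  have n1 : i ∉ α ∩ β := by simp [hi'.2]
  have n2 : j ∉ α ∩ β := by simp [hj'.2]
  generalize α ∩ β = σ at *
  subst ea eb
  rcases lt_or_gt_of_ne hij with h | h
  · exact qGood_lt q hl σ i j κ n1 n2 h hκ hσ
  · exact (qGood_lt q hl σ j i κ n2 n1 h hκ hσ).symm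

lemma qMinor_zero {R : Type*} [CommRing R] {n : ℕ} (q : Fin n → QPR)
    (P : Fin n → Fin n → R) (d : Fin n → R) (κ l : Fin n) (hκ : q κ ≠ QPR.A) (hκl : κ < l)
    (hl : (l : ℕ) + 1 = n) :
    qMinor (qFam (qMask q P) d) (Finset.Iic κ) (insert l (Finset.Iio κ)) = 0 := by
  have hcard : (insert l (Finset.Iio κ)).card = (Finset.Iic κ).card := by
    rw [Finset.card_insert_of_notMem (by simp [hκl.le])]; simp
  rw [qMinor_eq _ _ _ hcard]
  set a := (Finset.Iic κ).orderEmbOfFin rfl with ha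
  set b := (insert l (Finset.Iio κ)).orderEmbOfFin hcard with hb
  have hma : ∀ i, a i ∈ Finset.Iic κ := fun i => Finset.orderEmbOfFin_mem _ _ _
  have hmb : ∀ i, b i ∈ insert l (Finset.Iio κ) := fun i => Finset.orderEmbOfFin_mem _ _ _
  have hra : ∀ x ≤ κ, x ∈ Set.range a := by
    intro x hx
    rw [ha, Finset.range_orderEmbOfFin]; simpa using hx
  rw [qFam_det _ _ a b a a.injective]
  · obtain ⟨j, hj⟩ := hra κ le_rfl
    rw [Matrix.det_eq_zero_of_column_eq_zero (A := (qMask q P).submatrix b a) j, mul_zero]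
    intro i
    simp only [Matrix.submatrix_apply, qMask, Matrix.of_apply, hj]
    rw [if_neg]
    rintro ⟨h1, h2⟩
    have := hmb i
    rw [Finset.mem_insert, Finset.mem_Iio] at this
    rcases this with h | h
    · rw [h] at h2; exact hκ (h2 hl)
    · exact absurd h1 (not_le.2 h)
  · intro i x hx
    have h1 : ¬ x ≤ κ := fun h => hx (hra x h)
    have h2 := Finset.mem_Iic.1 (hma i)
    simp only [qMask, Matrix.of_apply]
    rw [if_neg, zero_mul]
    rintro ⟨h3, _⟩
    exact h1 (h3.trans h2)

end Helpers

/-- over a field of characteristic 0, every sequence whose terms all lie in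
`{A, S}` and whose last term is `A` is attainable. -/
theorem stmt_3 {F : Type*} [Field F] [CharZero F] {n : ℕ} (hn : 0 < n) (q : Fin n → QPR)
    (hq : ∀ k : Fin n, q k = QPR.A ∨ q k = QPR.S)
    (hlast : q ⟨n - 1, by omega⟩ = QPR.A) :
    Attainable F q := by
  have hl : ∀ x : Fin n, (x : ℕ) + 1 = n → q x = QPR.A := by
    intro x hx
    have : x = ⟨n - 1, by omega⟩ := Fin.ext (by simp; omega)
    rw [this]; exact hlast
  obtain ⟨P, d, hPd⟩ := exists_point (F := F) q
  refine ⟨qFam (qMask q P) d, qFam_symm _ _, fun k => ?_⟩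
  rcases hq k with hk | hk
  · rw [hk, qprEntry, if_pos]
    intro α β h
    exact hPd α β (qGood_pair q hl k hk α β h)
  · have hkA : q k ≠ QPR.A := by rw [hk]; simp
    have hkn : (k : ℕ) + 1 ≠ n := fun e => hkA (hl k e)
    have hkl : k < (⟨n - 1, by omega⟩ : Fin n) := by
      rw [Fin.lt_def]; have := k.2; simp; omega
    rw [hk, qprEntry, if_neg, if_neg]
    · intro h
      exact hPd _ _ (qGood_refl q hl (Finset.Iic k)) (h _ _ ⟨by simp, by simp, by simp⟩)
    · intro h
      refine h _ _ ⟨?_, ?_, ?_⟩ (qMinor_zero q P d k ⟨n - 1, by omega⟩ hkA hkl (by simp; omega))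
      · simp
      · rw [Finset.card_insert_of_notMem (by simp [hkl.le])]; simp
      · have : Finset.Iio k ⊆ Finset.Iic k ∩ insert (⟨n - 1, by omega⟩ : Fin n) (Finset.Iio k) := by
          intro x hx
          simp only [Finset.mem_inter, Finset.mem_Iic, Finset.mem_insert]
          exact ⟨(Finset.mem_Iio.1 hx).le, Or.inr hx⟩
        have := Finset.card_le_card this
        simpa using this
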